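/- Let p be a prime and Λ = ℤ_p[[T]]. Let g ∈ Λ be an element generating a nonzero prime ideal (g) of Λ with (g) ≠ (p). Then for all sufficiently large positive integers m, the ideal (g + p^m) is also a nonzero prime ideal of Λ (necessarily of height one), and there is an isomorphism of rings Λ/(g) ≅ Λ/(g + p^m). -/

import Mathlib

open Polynomial in
theorem aux_lim_zp (p : ℕ) [Fact p.Prime] (y : ℕ → ℤ_[p])
    (h : ∀ n, ∃ d, y (n+1) - y n = (p:ℤ_[p])^n * d) :
    ∃ L, ∀ n, ∃ d, L - y n = (p:ℤ_[p])^n * d := by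
  have key : ∀ m n, m ≤ n → ∃ d, y n - y m = (p:ℤ_[p])^m * d := by
    intro m n hmn
    induction n, hmn using Nat.le_induction with
    | base => exact ⟨0, by simp⟩
    | succ n hmn ih =>
      obtain ⟨d, hd⟩ := ih
      obtain ⟨e, he⟩ := h n
      obtain ⟨c, rfl⟩ := Nat.exists_eq_add_of_le hmn
      refine ⟨d + p^c * e, ?_⟩
      rw [mul_add, ← hd, ← mul_assoc, ← pow_add, ← he]; ring
  have hI := (inferInstance : IsPrecomplete (IsLocalRing.maximalIdeal ℤ_[p]) ℤ_[p])
  obtain ⟨L, hL⟩ := hI.prec (f := y) (by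
    intro m n hmn
    obtain ⟨d, hd⟩ := key m n hmn
    rw [SModEq.comm, SModEq.sub_mem]
    simp only [smul_eq_mul, ← Ideal.one_eq_top, mul_one, PadicInt.maximalIdeal_eq_span_p,
      Ideal.span_singleton_pow, Ideal.mem_span_singleton]
    exact ⟨d, hd⟩)
  refine ⟨L, fun n => ?_⟩
  have := hL n
  rw [SModEq.comm, SModEq.sub_mem] at this
  simp only [smul_eq_mul, ← Ideal.one_eq_top, mul_one, PadicInt.maximalIdeal_eq_span_p,
      Ideal.span_singleton_pow, Ideal.mem_span_singleton] at this
  exact this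

theorem aux_lim (p : ℕ) [Fact p.Prime] {B : Type*} [CommRing B] [Algebra ℤ_[p] B]
    [Module.Finite ℤ_[p] B] [Module.Free ℤ_[p] B] (y : ℕ → B)
    (h : ∀ n, ∃ d, y (n+1) - y n = (p:B)^n * d) :
    ∃ L, ∀ n, ∃ d, L - y n = (p:B)^n * d := by
  let b := Module.Free.chooseBasis ℤ_[p] B
  have hp : ∀ (n : ℕ) (d : B), (p:B)^n * d = ((p:ℤ_[p])^n) • d := by
    intro n d; rw [Algebra.smul_def]; simp
  have h1 : ∀ i, ∃ L, ∀ n, ∃ d, L - b.repr (y n) i = (p:ℤ_[p])^n * d := by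
    intro i
    apply aux_lim_zp
    intro n
    obtain ⟨d, hd⟩ := h n
    refine ⟨b.repr d i, ?_⟩
    rw [hp] at hd
    have := congrArg (fun z => b.repr z i) hd
    simpa using this
  choose L hL using h1
  choose d hd using hL
  refine ⟨∑ i, L i • b i, fun n => ⟨∑ i, d i n • b i, ?_⟩⟩
  rw [hp, Finset.smul_sum]
  conv_lhs => rw [← b.sum_repr (y n)]
  rw [← Finset.sum_sub_distrib]
  refine Finset.sum_congr rfl fun i _ => ?_
  rw [← sub_smul, hd, mul_smul]

theorem aux_haus (p : ℕ) [Fact p.Prime] {B : Type*} [CommRing B] [Algebra ℤ_[p] B]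
    [Module.Finite ℤ_[p] B] (z : B)
    (h : ∀ n, ∃ d, z = (p:B)^n * d) : z = 0 := by
  have hI := (inferInstance : IsHausdorff (IsLocalRing.maximalIdeal ℤ_[p]) B)
  apply hI.haus
  intro n
  rw [SModEq.zero]
  obtain ⟨d, hd⟩ := h n
  have : z = ((p:ℤ_[p])^n) • d := by rw [hd, Algebra.smul_def]; simp
  rw [this]
  refine Submodule.smul_mem_smul ?_ trivial
  apply Ideal.pow_mem_pow
  rw [PadicInt.maximalIdeal_eq_span_p]
  exact Ideal.mem_span_singleton_self _

open Polynomial in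
theorem aux_fix (p : ℕ) [Fact p.Prime] {B : Type*} [CommRing B] [Algebra ℤ_[p] B]
    [Module.Finite ℤ_[p] B] [Module.Free ℤ_[p] B] (v : B) (N : B[X]) :
    ∃ y, y = v + p * N.eval y := by
  let y : ℕ → B := fun n => Nat.rec 0 (fun _ z => v + p * N.eval z) n
  have hy : ∀ n, y (n+1) = v + p * N.eval (y n) := fun n => rfl
  obtain ⟨L, hL⟩ := aux_lim p y (by
    intro n
    induction n with
    | zero => exact ⟨y 1 - y 0, by simp⟩
    | succ n ih =>
      obtain ⟨d, hd⟩ := ih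
      obtain ⟨e, he⟩ := sub_dvd_eval_sub (y (n+1)) (y n) N
      refine ⟨d * e, ?_⟩
      rw [hy (n+1), hy n, ← hy n, add_sub_add_left_eq_sub, ← mul_sub, he, hd]; ring)
  refine ⟨L, ?_⟩
  rw [← sub_eq_zero]
  apply aux_haus p
  intro n
  obtain ⟨d, hd⟩ := hL n
  obtain ⟨d', hd'⟩ := hL (n+1)
  obtain ⟨e, he⟩ := sub_dvd_eval_sub L (y n) N
  refine ⟨p * d' - p * (d * e), ?_⟩
  have : L - (v + p * N.eval L) = (L - y (n+1)) - p * (N.eval L - N.eval (y n)) := by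
    rw [hy]; ring
  rw [this, hd', he, hd]; ring

open Polynomial in
theorem aux_main (p : ℕ) [Fact p.Prime] {B : Type*} [CommRing B] [Algebra ℤ_[p] B]
    [Module.Finite ℤ_[p] B] [Module.Free ℤ_[p] B] (τ : B)
    (hτ : Function.Surjective (aeval (R := ℤ_[p]) τ))
    (f a b : ℤ_[p][X]) (hf : f.Monic) (hr : Module.finrank ℤ_[p] B = f.natDegree)
    (k m : ℕ) (hab : b * derivative f + a * f = (p : ℤ_[p][X]) ^ k) (hm : 2 * k + 1 ≤ m)
    (v : B) (hv : aeval τ f = (p : B) ^ m * v) :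
    Nonempty (AdjoinRoot f ≃+* B) := by
  obtain ⟨j, rfl⟩ := Nat.exists_eq_add_of_le hm
  -- root of f congruent to τ mod p
  obtain ⟨x, hx, z, hxz⟩ : ∃ x, aeval x f = 0 ∧ ∃ z, x = τ + p * z := by
    -- invert 1 - p^(k+1+j) a v
    obtain ⟨c, hc⟩ := aux_fix p (1 : B) (C ((p:B)^(k+j) * aeval τ a * v) * X)
    simp only [eval_mul, eval_C, eval_X] at hc
    have hD : c * aeval τ b * aeval τ (derivative f) = (p:B)^k := by
      have h1 := congrArg (aeval τ) hab
      simp only [map_add, map_mul, map_pow, map_natCast, hv] at h1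
      have h2 : aeval τ b * aeval τ (derivative f) =
        (p:B)^k * (1 - p * ((p:B)^(k+j) * aeval τ a * v)) := by
        rw [eq_sub_of_add_eq h1]; ring
      rw [mul_assoc, h2]
      linear_combination (p:B)^k * hc
    set β := c * aeval τ b with hβ
    let F := taylor τ (f.map (algebraMap ℤ_[p] B))
    obtain ⟨S, hS⟩ : ∃ S : B[X], ∀ w, aeval (τ + w) f =
        aeval τ f + aeval τ (derivative f) * w + w^2 * S.eval w := by
      refine ⟨F.divX.divX, fun w => ?_⟩
      have e1 : aeval (τ + w) f = F.eval w := by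
        rw [taylor_eval, eval_map_algebraMap, add_comm]
      have e2 : F.eval w = (F.divX.divX.eval w * w + F.divX.coeff 0) * w + F.coeff 0 := by
        conv_lhs => rw [← divX_mul_X_add F, ← divX_mul_X_add F.divX]
        simp
      have e3 : F.coeff 0 = aeval τ f := by
        simp [F, taylor_coeff_zero, eval_map_algebraMap]
      have e4 : F.divX.coeff 0 = aeval τ (derivative f) := by
        simp [F, coeff_divX, taylor_coeff_one, derivative_map, eval_map_algebraMap]
      rw [e1, e2, e3, e4]; ring
    let e := k + 1 + j
    obtain ⟨y, hy⟩ := aux_fix p (-v)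
      (-(C ((p:B)^j * β^2) * X^2 * S.comp (C ((p:B)^e * β) * X)))
    simp only [eval_neg, eval_mul, eval_C, eval_X, eval_pow, eval_comp] at hy
    refine ⟨τ + (p:B)^e * β * y, ?_, (p:B)^(k+j) * β * y, by simp only [e]; ring⟩
    rw [hS, hv]
    linear_combination (p:B)^e * y * hD + (p:B)^(2*k+1+j) * hy
  let φ : AdjoinRoot f →ₐ[ℤ_[p]] B := AdjoinRoot.liftAlgHom f (Algebra.ofId _ _) x hx
  have hφ : ∀ r : ℤ_[p][X], φ (AdjoinRoot.mk f r) = aeval x r := fun r => by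
    simp [φ, aeval_def, Algebra.ofId]
  have hsurj : Function.Surjective φ := by
    rw [← AlgHom.coe_toLinearMap, ← LinearMap.range_eq_top, eq_top_iff]
    refine Submodule.le_of_le_smul_of_le_jacobson_bot (I := IsLocalRing.maximalIdeal ℤ_[p])
      (Module.Finite.fg_top) (IsLocalRing.maximalIdeal_le_jacobson _) ?_
    intro s _
    obtain ⟨r, rfl⟩ := hτ s
    obtain ⟨e, he⟩ := sub_dvd_eval_sub τ x (r.map (algebraMap ℤ_[p] B))
    rw [eval_map_algebraMap, eval_map_algebraMap] at he
    have : aeval τ r = aeval x r + (p : ℤ_[p]) • (-z * e) := by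
      rw [Algebra.smul_def, map_natCast, ← sub_eq_iff_eq_add', he, hxz]; ring
    rw [this]
    refine Submodule.add_mem_sup ⟨AdjoinRoot.mk f r, hφ r⟩ (Submodule.smul_mem_smul ?_ trivial)
    rw [PadicInt.maximalIdeal_eq_span_p]
    exact Ideal.mem_span_singleton_self _
  have := hf.free_adjoinRoot
  have := hf.finite_adjoinRoot
  have hrk : Module.finrank ℤ_[p] (AdjoinRoot f) = Module.finrank ℤ_[p] B := by
    rw [hr, (AdjoinRoot.powerBasis' hf).finrank, AdjoinRoot.powerBasis'_dim]
  let E := LinearEquiv.ofFinrankEq _ _ hrk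
  have hinj : Function.Injective φ := by
    have := OrzechProperty.injective_of_surjective_endomorphism
      (E.symm.toLinearMap.comp φ.toLinearMap) (E.symm.surjective.comp hsurj)
    exact Function.Injective.of_comp this
  exact ⟨RingEquiv.ofBijective φ ⟨hinj, hsurj⟩⟩

open Polynomial in
theorem aux_bezout (p : ℕ) [Fact p.Prime] (f : ℤ_[p][X]) (hf : f.Monic)
    (hd : IsDomain (AdjoinRoot f)) (h0 : f.natDegree ≠ 0) :
    ∃ (k : ℕ) (a b : ℤ_[p][X]), b * derivative f + a * f = (p : ℤ_[p][X]) ^ k := by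
  have := hf.finite_adjoinRoot
  have hne : AdjoinRoot.mk f (derivative f) ≠ 0 :=
    AdjoinRoot.mk_ne_zero_of_natDegree_lt hf
      (fun h => h0 (derivative_eq_zero.1 h)) (natDegree_derivative_lt h0)
  have := Ideal.comap_ne_bot_of_integral_mem (R := ℤ_[p]) hne
    (Ideal.mem_span_singleton_self _) (Algebra.IsIntegral.isIntegral _)
  obtain ⟨z, hz, hz0⟩ := Submodule.exists_mem_ne_zero_of_ne_bot this
  rw [Ideal.mem_comap, Ideal.mem_span_singleton] at hz
  obtain ⟨c, hc⟩ := hz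
  obtain ⟨c, rfl⟩ := AdjoinRoot.mk_surjective c
  have hz1 := PadicInt.unitCoeff_spec hz0
  set u := PadicInt.unitCoeff hz0
  have : AdjoinRoot.mk f (C ((u⁻¹ : ℤ_[p]ˣ) : ℤ_[p]) * c * derivative f - (p : ℤ_[p][X]) ^ z.valuation) = 0 := by
    have h2 : AdjoinRoot.mk f (C z) = AdjoinRoot.mk f (derivative f) * AdjoinRoot.mk f c := hc
    have h3 : C ((u⁻¹ : ℤ_[p]ˣ) : ℤ_[p]) * C z = (p : ℤ_[p][X]) ^ z.valuation := by
      rw [← C_mul]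
      conv_lhs => rw [hz1]
      simp
    rw [← h3, map_sub, map_mul, map_mul, map_mul, h2]; ring
  rw [AdjoinRoot.mk_eq_zero] at this
  obtain ⟨a, ha⟩ := this
  exact ⟨z.valuation, -a, C ((u⁻¹ : ℤ_[p]ˣ) : ℤ_[p]) * c, by linear_combination ha⟩

theorem perturbed_height_one_prime (p : ℕ) [Fact p.Prime]
    (g : PowerSeries ℤ_[p])
    (hprime : (Ideal.span {g}).IsPrime)
    (hne0 : Ideal.span {g} ≠ (⊥ : Ideal (PowerSeries ℤ_[p])))
    (hnep : Ideal.span {g} ≠ Ideal.span {(p : PowerSeries ℤ_[p])}) :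
    ∃ M : ℕ, ∀ m : ℕ, M ≤ m → 0 < m →
      (Ideal.span {g + (p : PowerSeries ℤ_[p]) ^ m}).IsPrime ∧
      Ideal.span {g + (p : PowerSeries ℤ_[p]) ^ m} ≠
        (⊥ : Ideal (PowerSeries ℤ_[p])) ∧
      Nonempty
        ((PowerSeries ℤ_[p] ⧸ Ideal.span {g}) ≃+*
          (PowerSeries ℤ_[p] ⧸ Ideal.span {g + (p : PowerSeries ℤ_[p]) ^ m})) := by
  have hg0 : g ≠ 0 := fun h => hne0 (by simp [h])
  have hgp : Prime g := (Ideal.span_singleton_prime hg0).1 hprime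
  have hpres : IsLocalRing.residue ℤ_[p] (p : ℤ_[p]) = 0 := by
    rw [IsLocalRing.residue_eq_zero_iff, PadicInt.maximalIdeal_eq_span_p]
    exact Ideal.mem_span_singleton_self _
  have hpnu : ¬ IsUnit (p : PowerSeries ℤ_[p]) := by
    intro h
    have h1 := h.map (PowerSeries.constantCoeff (R := ℤ_[p]))
    rw [map_natCast] at h1
    exact PadicInt.p_nonunit h1
  have hgm : g.map (IsLocalRing.residue ℤ_[p]) ≠ 0 := by
    intro h
    have h1 : ∀ n, ∃ c, PowerSeries.coeff n g = p * c := by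
      intro n
      have := congrArg (PowerSeries.coeff n) h
      rw [PowerSeries.coeff_map, map_zero, IsLocalRing.residue_eq_zero_iff,
        PadicInt.maximalIdeal_eq_span_p, Ideal.mem_span_singleton] at this
      exact this
    choose c hc using h1
    have h2 : g = (p : PowerSeries ℤ_[p]) * PowerSeries.mk c := by
      ext n
      rw [hc, ← map_natCast (PowerSeries.C (R := ℤ_[p])), PowerSeries.coeff_C_mul,
        PowerSeries.coeff_mk]
    rcases hgp.irreducible.isUnit_or_isUnit h2 with h3 | h3
    · exact hpnu h3
    · apply hnep
      rw [h2, Ideal.span_singleton_mul_right_unit h3]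
  obtain ⟨f, u, H⟩ := PowerSeries.exists_isWeierstrassFactorization hgm
  have hfm := H.isDistinguishedAt.monic
  let E := H.algEquivQuotient
  have hdom : IsDomain (AdjoinRoot f) := by
    have : IsDomain (PowerSeries ℤ_[p] ⧸ Ideal.span {g}) := inferInstance
    exact E.toRingEquiv.toMulEquiv.isDomain _
  have hdeg : f.natDegree ≠ 0 := by
    intro h
    have h1 : f = 1 := hfm.natDegree_eq_zero.1 h
    apply hgp.not_isUnit
    rw [H.eq_mul, h1]
    simpa using H.isUnit
  obtain ⟨k, a, b, hab⟩ := aux_bezout p f hfm hdom hdeg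
  refine ⟨2 * k + 1, fun m hm hm0 => ?_⟩
  have hqg : (g + (p : PowerSeries ℤ_[p]) ^ m).map (IsLocalRing.residue ℤ_[p])
      = g.map (IsLocalRing.residue ℤ_[p]) := by
    have : (PowerSeries.map (IsLocalRing.residue ℤ_[p])) (p : PowerSeries ℤ_[p]) = 0 := by
      rw [← map_natCast (PowerSeries.C (R := ℤ_[p])), PowerSeries.map_C, hpres, map_zero]
    rw [map_add, map_pow, this, zero_pow hm0.ne', add_zero]
  have hqm : (g + (p : PowerSeries ℤ_[p]) ^ m).map (IsLocalRing.residue ℤ_[p]) ≠ 0 := by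
    rwa [hqg]
  have hq0 : g + (p : PowerSeries ℤ_[p]) ^ m ≠ 0 := fun h => hqm (by rw [h, map_zero])
  set q := g + (p : PowerSeries ℤ_[p]) ^ m with hq
  obtain ⟨f', u', H'⟩ := PowerSeries.exists_isWeierstrassFactorization hqm
  have hfm' := H'.isDistinguishedAt.monic
  have hnat : f'.natDegree = f.natDegree := by
    rw [H.natDegree_eq_toNat_order_map, H'.natDegree_eq_toNat_order_map, hqg]
  let E' : AdjoinRoot f' ≃ₐ[ℤ_[p]] PowerSeries ℤ_[p] ⧸ Ideal.span {q} := H'.algEquivQuotient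
  have hE' : ∀ r : Polynomial ℤ_[p], E' (AdjoinRoot.mk f' r) =
      Ideal.Quotient.mk _ (r : PowerSeries ℤ_[p]) := by
    intro r
    change H'.algEquivQuotient (Ideal.Quotient.mk _ r) = _
    simp
  have := hfm'.free_adjoinRoot
  have := hfm'.finite_adjoinRoot
  have : Module.Finite ℤ_[p] (PowerSeries ℤ_[p] ⧸ Ideal.span {q}) :=
    Module.Finite.equiv E'.toLinearEquiv
  have : Module.Free ℤ_[p] (PowerSeries ℤ_[p] ⧸ Ideal.span {q}) :=
    Module.Free.of_equiv E'.toLinearEquiv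
  have hτ : ∀ r : Polynomial ℤ_[p], Polynomial.aeval (E' (AdjoinRoot.root f')) r =
      E' (AdjoinRoot.mk f' r) := by
    intro r
    rw [Polynomial.aeval_algHom_apply, AdjoinRoot.aeval_eq]
  obtain ⟨w, hw⟩ := H.isUnit
  obtain ⟨e⟩ := aux_main p (E' (AdjoinRoot.root f'))
    (fun s => by
      obtain ⟨t, rfl⟩ := E'.surjective s
      obtain ⟨r, rfl⟩ := AdjoinRoot.mk_surjective t
      exact ⟨r, hτ r⟩) f a b hfm
    (by rw [← E'.toLinearEquiv.finrank_eq, (AdjoinRoot.powerBasis' hfm').finrank,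
      AdjoinRoot.powerBasis'_dim, hnat]) k m hab hm
    (Ideal.Quotient.mk _ (-((w⁻¹ : (PowerSeries ℤ_[p])ˣ) : PowerSeries ℤ_[p])))
    (by
      rw [hτ, hE', ← map_natCast (Ideal.Quotient.mk (Ideal.span {q})), ← map_pow, ← map_mul,
        Ideal.Quotient.mk_eq_mk_iff_sub_mem, Ideal.mem_span_singleton]
      refine ⟨((w⁻¹ : (PowerSeries ℤ_[p])ˣ) : PowerSeries ℤ_[p]), ?_⟩
      have h1 := H.eq_mul
      rw [← hw] at h1
      rw [hq, h1]
      linear_combination (-(f : PowerSeries ℤ_[p])) * w.mul_inv)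
  have e2 : (PowerSeries ℤ_[p] ⧸ Ideal.span {g}) ≃+* (PowerSeries ℤ_[p] ⧸ Ideal.span {q}) :=
    E.symm.toRingEquiv.trans e
  refine ⟨?_, by simpa using hq0, ⟨e2⟩⟩
  rw [← Ideal.Quotient.isDomain_iff_prime]
  exact e2.symm.toMulEquiv.isDomain _
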